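/- Let r ≥ 2 be an integer and let F be a graph satisfying Hypothesis (★). Then for all sufficiently large n, every spectral-extremal graph G for F on n vertices is connected. -/

import Mathlib

open SimpleGraph

/-- The adjacency matrix of a simple graph over `ℝ`. -/
noncomputable def adjMat {V : Type*} [Fintype V] (G : SimpleGraph V) : Matrix V V ℝ :=
  letI := Classical.decRel G.Adj
  G.adjMatrix ℝ

/-- The spectral radius of a simple graph: the largest eigenvalue of its adjacency matrix. -/
noncomputable def specRad {V : Type*} [Fintype V] [DecidableEq V] (G : SimpleGraph V) : ℝ :=
  sSup (spectrum ℝ (adjMat G))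

/-- The number of edges of a simple graph. -/
noncomputable def eCnt {V : Type*} (G : SimpleGraph V) : ℕ := Nat.card G.edgeSet

/-- `G` contains a copy of `F` (a subgraph isomorphic to `F`). -/
def Contains {W V : Type*} (F : SimpleGraph W) (G : SimpleGraph V) : Prop :=
  ∃ f : F →g G, Function.Injective f

/-- `G` is `F`-free. -/
def FFree {W V : Type*} (F : SimpleGraph W) (G : SimpleGraph V) : Prop := ¬ Contains F G

/-- The Turán number `ex(n, F)`. -/
noncomputable def exNum {W : Type*} (n : ℕ) (F : SimpleGraph W) : ℕ :=
  sSup {m | ∃ G : SimpleGraph (Fin n), FFree F G ∧ eCnt G = m}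

/-- `G` is obtained from the Turán graph `T_{n,r}` by adding `a` edges. -/
def TuranPlus (n r a : ℕ) (G : SimpleGraph (Fin n)) : Prop :=
  (∃ H : SimpleGraph (Fin n), H ≤ G ∧ Nonempty (H ≃g turanGraph n r)) ∧
    eCnt G = eCnt (turanGraph n r) + a

/-- Hypothesis (★): for all sufficiently large `m`, `ex(m,F) = e(T_{m,r}) + a` and every
extremal graph is obtained from `T_{m,r}` by adding `a` edges. -/
def HypStar {W : Type*} (r a : ℕ) (F : SimpleGraph W) : Prop :=
  ∃ m₀ : ℕ, ∀ m ≥ m₀,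
    exNum m F = eCnt (turanGraph m r) + a ∧
    ∀ G : SimpleGraph (Fin m), FFree F G → eCnt G = exNum m F → TuranPlus m r a G

/-- `G` is a spectral-extremal `F`-free graph on its vertex set. -/
def SpecExtremal {W : Type*} (F : SimpleGraph W) {n : ℕ} (G : SimpleGraph (Fin n)) : Prop :=
  FFree F G ∧ ∀ G' : SimpleGraph (Fin n), FFree F G' → specRad G' ≤ specRad G

theorem adjMat_apply {V : Type*} [Fintype V] (G : SimpleGraph V) (i j : V)
    [Decidable (G.Adj i j)] : adjMat G i j = if G.Adj i j then 1 else 0 := by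
  unfold adjMat
  rw [SimpleGraph.adjMatrix_apply]
  congr

theorem isHermitian_adjMat {V : Type*} [Fintype V] (G : SimpleGraph V) :
    (adjMat G).IsHermitian := by
  classical
  ext i j
  simp [Matrix.conjTranspose_apply, adjMat_apply, G.adj_comm]

theorem isGreatest_specRad {V : Type*} [Fintype V] [DecidableEq V] [Nonempty V]
    (G : SimpleGraph V) : IsGreatest (spectrum ℝ (adjMat G)) (specRad G) := by
  have hs := (isHermitian_adjMat G).spectrum_real_eq_range_eigenvalues
  have hfin : (spectrum ℝ (adjMat G)).Finite := hs ▸ Set.finite_range _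
  have hne : (spectrum ℝ (adjMat G)).Nonempty := hs ▸ Set.range_nonempty _
  exact ⟨hne.csSup_mem hfin, fun x hx => le_csSup hfin.bddAbove hx⟩

/-- The Rayleigh bound for the spectral radius. -/
theorem sum_adjMat_mul_le_specRad_mul {V : Type*} [Fintype V] [DecidableEq V] [Nonempty V]
    (G : SimpleGraph V) (y : V → ℝ) :
    ∑ i, ∑ j, y i * adjMat G i j * y j ≤ specRad G * ∑ i, y i ^ 2 := by
  have hpos : (algebraMap ℝ (Matrix V V ℝ) (specRad G) - adjMat G).PosSemidef := by
    rw [Matrix.posSemidef_iff_isHermitian_and_spectrum_nonneg]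
    refine ⟨.sub ?_ (isHermitian_adjMat G), ?_⟩
    · rw [Matrix.algebraMap_eq_diagonal]
      exact Matrix.isHermitian_diagonal _
    · rw [← spectrum.singleton_sub_eq]
      rintro _ ⟨_, rfl, x, hx, rfl⟩
      exact sub_nonneg.mpr ((isGreatest_specRad G).2 hx)
  have h := hpos.dotProduct_mulVec_nonneg y
  have h₁ : y ⬝ᵥ (adjMat G).mulVec y = ∑ i, ∑ j, y i * adjMat G i j * y j := by
    simp [dotProduct, Matrix.mulVec, Finset.mul_sum, mul_assoc]
  have h₂ : y ⬝ᵥ (algebraMap ℝ (Matrix V V ℝ) (specRad G)).mulVec y =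
      specRad G * ∑ i, y i ^ 2 := by
    rw [Algebra.algebraMap_eq_smul_one, Matrix.smul_mulVec, Matrix.one_mulVec, dotProduct_smul,
      smul_eq_mul, dotProduct]
    simp [sq]
  rw [star_trivial, Matrix.sub_mulVec, dotProduct_sub, h₁, h₂] at h
  linarith

theorem exists_eigenvector_specRad {V : Type*} [Fintype V] [DecidableEq V] [Nonempty V]
    (G : SimpleGraph V) :
    ∃ x : V → ℝ, x ≠ 0 ∧ ∀ i, ∑ j, adjMat G i j * x j = specRad G * x i := by
  have hG := isHermitian_adjMat G
  obtain ⟨k, hk⟩ := hG.spectrum_real_eq_range_eigenvalues ▸ (isGreatest_specRad G).1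
  refine ⟨hG.eigenvectorBasis k, fun h0 => ?_, fun i => ?_⟩
  · exact hG.eigenvectorBasis.orthonormal.ne_zero k (by ext i; exact congrFun h0 i)
  · have := congrFun (hG.mulVec_eigenvectorBasis k) i
    rw [hk] at this
    simpa [Matrix.mulVec, dotProduct] using this

theorem two_mul_eCnt_le_specRad_mul {V : Type*} [Fintype V] [DecidableEq V] [Nonempty V]
    (G : SimpleGraph V) : 2 * (eCnt G : ℝ) ≤ specRad G * Fintype.card V := by
  classical
  have h := sum_adjMat_mul_le_specRad_mul G fun _ => 1
  have hdeg : ∑ i, ∑ j, adjMat G i j = ((∑ i, G.degree i : ℕ) : ℝ) := by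
    push_cast
    refine Finset.sum_congr rfl fun i _ => ?_
    simp [adjMat_apply, ← SimpleGraph.card_neighborFinset_eq_degree,
      SimpleGraph.neighborFinset_eq_filter]
  have hcard : eCnt G = G.edgeFinset.card := by
    rw [eCnt, Nat.card_eq_fintype_card, SimpleGraph.edgeFinset_card]
  rw [G.sum_degrees_eq_twice_card_edges, ← hcard] at hdeg
  simpa [hdeg] using h

/-- Isolate the vertex `v` and then attach it to `u` as a pendant vertex. -/
def pendantAt {V : Type*} (G : SimpleGraph V) (u v : V) (huv : u ≠ v) : SimpleGraph V where
  Adj i j := (G.Adj i j ∧ i ≠ v ∧ j ≠ v) ∨ (i = u ∧ j = v) ∨ (i = v ∧ j = u)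
  symm := ⟨by
    rintro i j (⟨h, hi, hj⟩ | h | h)
    · exact .inl ⟨h.symm, hj, hi⟩
    · exact .inr (.inr h.symm)
    · exact .inr (.inl h.symm)⟩
  loopless := ⟨by
    rintro i (⟨h, -, -⟩ | ⟨rfl, h⟩ | ⟨rfl, h⟩)
    · exact G.loopless.irrefl i h
    · exact huv h
    · exact huv h.symm⟩

/-- Attaching a pendant vertex to a vertex of large degree creates no new copy of `F`. -/
theorem FFree.pendantAt {W V : Type*} [Fintype V] {F : SimpleGraph W} {G : SimpleGraph V}
    (hG : FFree F G) {u v : V} (huv : u ≠ v) (hadj : ¬ G.Adj u v)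
    (hdeg : Nat.card W ≤ Nat.card (G.neighborSet u)) : FFree F (pendantAt G u v huv) := by
  classical
  rintro ⟨f, hf⟩
  have : Finite W := Finite.of_injective f hf
  have := Fintype.ofFinite W
  by_cases hv : ∃ w w', F.Adj w w' ∧ f w = v
  · obtain ⟨w, w', hww', hw⟩ := hv
    have nbr : ∀ t, F.Adj w t → f t = u := by
      intro t ht
      rcases f.map_rel ht with ⟨-, h, -⟩ | ⟨h, -⟩ | ⟨-, h⟩
      · exact absurd hw h
      · exact absurd (h.symm.trans hw) huv
      · exact h
    obtain ⟨p, hp, hpf⟩ : ∃ p, G.Adj u p ∧ ∀ t, f t ≠ p := by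
      by_contra! hcon
      have hsub : G.neighborFinset u ⊆ (Finset.univ.image f).erase v := by
        intro p hp
        rw [SimpleGraph.mem_neighborFinset] at hp
        obtain ⟨t, ht⟩ := hcon p hp
        refine Finset.mem_erase.mpr ⟨?_, Finset.mem_image.mpr ⟨t, Finset.mem_univ _, ht⟩⟩
        rintro rfl
        exact hadj hp
      have h₁ := Finset.card_le_card hsub
      rw [Finset.card_erase_of_mem (Finset.mem_image.mpr ⟨w, Finset.mem_univ _, hw⟩),
        Finset.card_image_of_injective _ hf, Finset.card_univ,
        SimpleGraph.card_neighborFinset_eq_degree, ← SimpleGraph.card_neighborSet_eq_degree] at h₁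
      rw [Nat.card_eq_fintype_card, Nat.card_eq_fintype_card] at hdeg
      have : 0 < Fintype.card W := Fintype.card_pos_iff.mpr ⟨w⟩
      omega
    have old : ∀ s t, s ≠ w → t ≠ w → F.Adj s t → G.Adj (f s) (f t) := by
      intro s t hs ht hst
      rcases f.map_rel hst with ⟨h, -, -⟩ | ⟨-, h⟩ | ⟨h, -⟩
      · exact h
      · exact absurd (hf (h.trans hw.symm)) ht
      · exact absurd (hf (h.trans hw.symm)) hs
    refine hG ⟨⟨Function.update f w p, ?_⟩, ?_⟩
    · intro s t hst
      by_cases hs : s = w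
      · subst hs
        rw [Function.update_self, Function.update_of_ne hst.ne', nbr t hst]
        exact hp.symm
      · by_cases ht : t = w
        · subst ht
          rw [Function.update_self, Function.update_of_ne hs, nbr s hst.symm]
          exact hp
        · rw [Function.update_of_ne hs, Function.update_of_ne ht]
          exact old s t hs ht hst
    · intro s t hst
      change Function.update f w p s = Function.update f w p t at hst
      by_cases hs : s = w <;> by_cases ht : t = w
      · rw [hs, ht]
      · subst hs
        rw [Function.update_self, Function.update_of_ne ht] at hst
        exact absurd hst.symm (hpf t)
      · subst ht
        rw [Function.update_self, Function.update_of_ne hs] at hst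
        exact absurd hst (hpf s)
      · rw [Function.update_of_ne hs, Function.update_of_ne ht] at hst
        exact hf hst
  · push Not at hv
    refine hG ⟨⟨f, ?_⟩, hf⟩
    intro s t hst
    rcases f.map_rel hst with ⟨h, -, -⟩ | ⟨-, h⟩ | ⟨h, -⟩
    · exact h
    · exact absurd h (hv t s hst.symm)
    · exact absurd h (hv s t hst)

/-- Attaching a vertex of another component to a vertex at which some eigenvector for the spectral
radius does not vanish increases the spectral radius. -/
theorem specRad_lt_specRad_pendantAt {V : Type*} [Fintype V] [DecidableEq V]
    {G : SimpleGraph V} (hpos : 0 < specRad G) {x : V → ℝ}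
    (hx : ∀ i, ∑ j, adjMat G i j * x j = specRad G * x i) {u v : V} (hu : x u ≠ 0)
    (huv : u ≠ v) (hreach : ¬ G.Reachable u v) :
    specRad G < specRad (pendantAt G u v huv) := by
  classical
  have : Nonempty V := ⟨u⟩
  set z : V → ℝ := fun i => if G.Reachable u i then x i else 0 with hz
  have hzu : z u = x u := if_pos (SimpleGraph.Reachable.refl u)
  have hzv : z v = 0 := if_neg hreach
  have hzeig : ∀ i, ∑ j, z i * adjMat G i j * z j = specRad G * z i ^ 2 := by
    intro i
    by_cases hi : G.Reachable u i
    · have : ∀ j, z i * adjMat G i j * z j = x i * (adjMat G i j * x j) := by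
        intro j
        by_cases hij : G.Adj i j
        · simp [hz, hi, hi.trans hij.reachable, mul_assoc]
        · simp [adjMat_apply, hij]
      simp_rw [this]
      rw [← Finset.mul_sum, hx, hz]
      simp only [hi, if_true]
      ring
    · simp [hz, hi]
  set ε : ℝ := x u / specRad G with hε
  set y : V → ℝ := fun i => if i = v then ε else z i with hy
  have hentry : ∀ i j, y i * adjMat (pendantAt G u v huv) i j * y j =
      z i * adjMat G i j * z j + (if i = u then if j = v then x u * ε else 0 else 0) +
        (if i = v then if j = u then x u * ε else 0 else 0) := by
    intro i j
    rw [adjMat_apply, adjMat_apply]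
    by_cases hi : i = v
    · subst hi
      by_cases hj : j = u
      · subst hj
        simp [pendantAt, hy, hzv, huv, huv.symm, hzu, mul_comm]
      · simp [pendantAt, hj, huv.symm, hzv]
    · by_cases hj : j = v
      · subst hj
        by_cases hiu : i = u
        · subst hiu
          simp [pendantAt, hy, hzv, huv, hzu]
        · simp [pendantAt, hiu, hi, hzv]
      · simp [pendantAt, hi, hj, hy]
  have hquad : ∑ i, ∑ j, y i * adjMat (pendantAt G u v huv) i j * y j =
      specRad G * ∑ i, z i ^ 2 + 2 * (x u * ε) := by
    simp_rw [hentry, Finset.sum_add_distrib, hzeig, ← Finset.mul_sum]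
    rw [add_assoc, two_mul]
    congr 2
    · rw [Finset.sum_eq_single u] <;> simp +contextual
    · rw [Finset.sum_eq_single v] <;> simp +contextual
  have hnorm : ∑ i, y i ^ 2 = ∑ i, z i ^ 2 + ε ^ 2 := by
    have : ∀ i, y i ^ 2 = z i ^ 2 + if i = v then ε ^ 2 else 0 := by
      intro i
      by_cases hi : i = v
      · simp [hy, hi, hzv]
      · simp [hy, hi]
    simp_rw [this, Finset.sum_add_distrib]
    simp
  have hray := sum_adjMat_mul_le_specRad_mul (pendantAt G u v huv) y
  rw [hquad, hnorm] at hray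
  have hxε : x u = specRad G * ε := by rw [hε]; field_simp
  have hε0 : ε ≠ 0 := div_ne_zero hu hpos.ne'
  have hε2 : 0 < ε ^ 2 := by positivity
  have hz2 : 0 ≤ ∑ i, z i ^ 2 := Finset.sum_nonneg fun i _ => sq_nonneg _
  by_contra! hle
  have := mul_le_mul_of_nonneg_right hle (add_nonneg hz2 hε2.le)
  rw [hxε] at hray
  nlinarith [mul_pos hpos hε2]

/-- The degree of a vertex maximizing the modulus of an eigenvector bounds the eigenvalue. -/
theorem le_card_neighborSet_of_eigenvector {V : Type*} [Fintype V] {G : SimpleGraph V}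
    {μ : ℝ} {x : V → ℝ} (hx : ∀ i, ∑ j, adjMat G i j * x j = μ * x i) {u : V} (hu : x u ≠ 0)
    (hmax : ∀ i, |x i| ≤ |x u|) : μ ≤ Nat.card (G.neighborSet u) := by
  classical
  have hsum : μ * x u = ∑ j ∈ G.neighborFinset u, x j := by
    rw [← hx u, SimpleGraph.neighborFinset_eq_filter, Finset.sum_filter]
    simp [adjMat_apply]
  have habs : |μ * x u| ≤ Nat.card (G.neighborSet u) * |x u| := by
    rw [hsum, Nat.card_eq_fintype_card, SimpleGraph.card_neighborSet_eq_degree,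
      ← SimpleGraph.card_neighborFinset_eq_degree, ← nsmul_eq_mul]
    exact (Finset.abs_sum_le_sum_abs _ _).trans (Finset.sum_le_card_nsmul _ _ _ fun i _ => hmax i)
  rw [abs_mul] at habs
  exact (le_abs_self μ).trans (le_of_mul_le_mul_right habs (abs_pos.mpr hu))

theorem mul_le_two_mul_eCnt_turanGraph {n r K : ℕ} (hr : 2 ≤ r) (hn : r * (K + 1) ≤ n) :
    K * n ≤ 2 * eCnt (turanGraph n r) := by
  have hcard : eCnt (turanGraph n r) = (turanGraph n r).edgeFinset.card := by
    rw [eCnt, Nat.card_eq_fintype_card, SimpleGraph.edgeFinset_card]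
  rw [hcard, SimpleGraph.card_edgeFinset_turanGraph]
  have hq : K + 1 ≤ n / r := (Nat.le_div_iff_mul_le (by omega)).mpr (by rwa [mul_comm])
  have hnq := Nat.div_add_mod n r
  set q := n / r
  set s := n % r
  have hsub : n ^ 2 - s ^ 2 = r * q * (n + s) := by
    rw [Nat.sq_sub_sq, mul_comm]
    congr 1
    omega
  have hdiv : (n ^ 2 - s ^ 2) * (r - 1) / (2 * r) = q * (n + s) * (r - 1) / 2 := by
    rw [hsub, show r * q * (n + s) * (r - 1) = r * (q * (n + s) * (r - 1)) by ring, mul_comm 2 r,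
      Nat.mul_div_mul_left _ _ (by omega)]
  have hge : (K + 1) * n ≤ q * (n + s) * (r - 1) :=
    calc (K + 1) * n ≤ q * (n + s) := Nat.mul_le_mul hq (by omega)
      _ ≤ q * (n + s) * (r - 1) := Nat.le_mul_of_pos_right _ (by omega)
  have hnpos : 1 ≤ n := by nlinarith
  rw [hdiv]
  rw [add_mul] at hge
  omega

theorem exists_FFree_eCnt_eq_exNum {W : Type*} {F : SimpleGraph W} {n : ℕ} (h : 0 < exNum n F) :
    ∃ G : SimpleGraph (Fin n), FFree F G ∧ eCnt G = exNum n F := by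
  have hne : {m | ∃ G : SimpleGraph (Fin n), FFree F G ∧ eCnt G = m}.Nonempty := by
    by_contra hcon
    rw [Set.not_nonempty_iff_eq_empty] at hcon
    simp [exNum, hcon] at h
  have hfin : {m | ∃ G : SimpleGraph (Fin n), FFree F G ∧ eCnt G = m}.Finite :=
    (Set.finite_range fun G : SimpleGraph (Fin n) => eCnt G).subset
      fun m ⟨G, _, hG⟩ => ⟨G, hG⟩
  exact Nat.sSup_mem hne hfin.bddAbove

theorem stmt_6 {W : Type*} (r a : ℕ) (hr : 2 ≤ r) (F : SimpleGraph W) (h : HypStar r a F) :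
    ∃ n₀ : ℕ, ∀ n ≥ n₀, ∀ G : SimpleGraph (Fin n), SpecExtremal F G → G.Connected := by
  obtain ⟨m₀, hm⟩ := h
  set K := Nat.card W + 1 with hK
  refine ⟨m₀ + r * (K + 1), fun n hn G ⟨hfree, hext⟩ => ?_⟩
  have hnpos : 0 < n := by nlinarith
  have : Nonempty (Fin n) := ⟨⟨0, hnpos⟩⟩
  have hturan := mul_le_two_mul_eCnt_turanGraph (K := K) hr (le_of_add_le_right hn)
  have hex := (hm n (le_of_add_le_left hn)).1
  have hKn : 0 < K * n := by positivity
  obtain ⟨H, hHfree, hH⟩ := exists_FFree_eCnt_eq_exNum (F := F) (n := n) (by omega)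
  have hlarge : (K : ℝ) ≤ specRad G := by
    have h₁ := two_mul_eCnt_le_specRad_mul H
    have h₂ : (K : ℝ) * n ≤ 2 * (eCnt H : ℝ) := by
      exact_mod_cast (by omega : K * n ≤ 2 * eCnt H)
    rw [Fintype.card_fin] at h₁
    exact (le_of_mul_le_mul_right (h₂.trans h₁) (by exact_mod_cast hnpos)).trans (hext H hHfree)
  have hpos : 0 < specRad G := lt_of_lt_of_le (by positivity) hlarge
  obtain ⟨x, hx0, hx⟩ := exists_eigenvector_specRad G
  obtain ⟨u, hmax⟩ := Finite.exists_max fun i => |x i|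
  have hu : x u ≠ 0 := fun h0 => hx0 <| funext fun i => by simpa [h0] using hmax i
  have hdeg : Nat.card W ≤ Nat.card (G.neighborSet u) := by
    have hle := hlarge.trans (le_card_neighborSet_of_eigenvector hx hu hmax)
    have : K ≤ Nat.card (G.neighborSet u) := by exact_mod_cast hle
    omega
  rw [SimpleGraph.connected_iff_exists_forall_reachable]
  refine ⟨u, fun v => ?_⟩
  by_contra hreach
  have huv : u ≠ v := by
    rintro rfl
    exact hreach (SimpleGraph.Reachable.refl u)
  have hlt := specRad_lt_specRad_pendantAt hpos hx hu huv hreach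
  exact hlt.not_ge (hext _ (hfree.pendantAt huv (fun h => hreach h.reachable) hdeg))
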